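/- Let A = k⟨x₁,…,xₛ⟩ be a free associative algebra over a field k. The centralizer of any element f ∈ A \ k is a commutative subalgebra of A. -/

import Mathlib

namespace CentFree

open MonoidAlgebra

variable {k : Type*} [Field k] {X : Type*}

/-- The degree: maximal length of a word in the support. -/
noncomputable def deg (a : MonoidAlgebra k (FreeMonoid X)) : ℕ :=
  a.coeff.support.sup FreeMonoid.length

theorem le_deg {a : MonoidAlgebra k (FreeMonoid X)} {v : FreeMonoid X} (h : a.coeff v ≠ 0) :
    v.length ≤ deg a :=
  Finset.le_sup (f := FreeMonoid.length) (Finsupp.mem_support_iff.2 h)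

theorem deg_le {a : MonoidAlgebra k (FreeMonoid X)} {m : ℕ}
    (h : ∀ v, a.coeff v ≠ 0 → v.length ≤ m) : deg a ≤ m :=
  Finset.sup_le fun v hv => h v (Finsupp.mem_support_iff.1 hv)

theorem exists_top {a : MonoidAlgebra k (FreeMonoid X)} (h : a ≠ 0) :
    ∃ v, v.length = deg a ∧ a.coeff v ≠ 0 := by
  have hne : a.coeff.support.Nonempty := by
    rw [Finsupp.support_nonempty_iff]
    simpa using h
  obtain ⟨v, hv, hv'⟩ := Finset.exists_mem_eq_sup _ hne FreeMonoid.length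
  exact ⟨v, hv'.symm, Finsupp.mem_support_iff.1 hv⟩

theorem mul_inj_of_length {a b c d : FreeMonoid X} (h : a * b = c * d)
    (hl : a.length = c.length) : a = c ∧ b = d :=
  List.append_inj h hl

theorem coeff_top_mul (a b : MonoidAlgebra k (FreeMonoid X)) {v w : FreeMonoid X}
    (hv : v.length = deg a) (hw : w.length = deg b) :
    (a * b).coeff (v * w) = a.coeff v * b.coeff w := by
  apply coeff_mul_mul_of_uniqueMul
  intro x y hx hy hxy
  have h1 := le_deg (Finsupp.mem_support_iff.1 hx)
  have h2 := le_deg (Finsupp.mem_support_iff.1 hy)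
  have h3 := congrArg FreeMonoid.length hxy
  rw [FreeMonoid.length_mul, FreeMonoid.length_mul] at h3
  exact mul_inj_of_length hxy (by omega)

theorem deg_mul_le (a b : MonoidAlgebra k (FreeMonoid X)) : deg (a * b) ≤ deg a + deg b := by
  classical
  apply deg_le
  intro v hv
  have := support_coeff_mul_subset a b (Finsupp.mem_support_iff.2 hv)
  obtain ⟨x, hx, y, hy, rfl⟩ := Finset.mem_mul.1 this
  rw [FreeMonoid.length_mul]
  exact add_le_add (le_deg (Finsupp.mem_support_iff.1 hx)) (le_deg (Finsupp.mem_support_iff.1 hy))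

theorem deg_mul {a b : MonoidAlgebra k (FreeMonoid X)} (ha : a ≠ 0) (hb : b ≠ 0) :
    deg (a * b) = deg a + deg b := by
  apply le_antisymm (deg_mul_le a b)
  obtain ⟨v, hv, hv'⟩ := exists_top ha
  obtain ⟨w, hw, hw'⟩ := exists_top hb
  rw [← hv, ← hw, ← FreeMonoid.length_mul]
  apply le_deg
  rw [coeff_top_mul a b hv hw]
  exact mul_ne_zero hv' hw'

theorem deg_one : deg (1 : MonoidAlgebra k (FreeMonoid X)) = 0 := by
  classical
  apply Nat.le_zero.1
  apply deg_le
  intro v hv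
  by_contra h
  apply hv
  rw [one_def, coeff_single, Finsupp.single_apply, if_neg]
  rintro rfl
  simp at h

theorem deg_pow {a : MonoidAlgebra k (FreeMonoid X)} (ha : a ≠ 0) (n : ℕ) :
    deg (a ^ n) = n * deg a := by
  induction n with
  | zero => simp [deg_one]
  | succ n ih => rw [pow_succ, deg_mul (pow_ne_zero n ha) ha, ih]; ring

theorem deg_sub_le (a b : MonoidAlgebra k (FreeMonoid X)) :
    deg (a - b) ≤ max (deg a) (deg b) := by
  apply deg_le
  intro v hv
  by_cases h : a.coeff v = 0
  · have : b.coeff v ≠ 0 := by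
      intro h'
      apply hv
      simp [h, h']
    exact le_max_of_le_right (le_deg this)
  · exact le_max_of_le_left (le_deg h)

theorem eq_algebraMap_of_deg {a : MonoidAlgebra k (FreeMonoid X)} (h : deg a = 0) :
    a = algebraMap k _ (a.coeff 1) := by
  classical
  ext v
  rw [coe_algebraMap]
  simp only [Function.comp, coeff_single, Finsupp.single_apply, Algebra.algebraMap_self,
    RingHom.id_apply]
  split_ifs with hv
  · rw [hv]
  · by_contra h'
    have := le_deg h'
    rw [h, Nat.le_zero, FreeMonoid.length_eq_zero] at this
    exact hv this.symm

theorem split_word (v : FreeMonoid X) (m : ℕ) (h : m ≤ v.length) :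
    ∃ x y : FreeMonoid X, x * y = v ∧ x.length = m := by
  refine ⟨FreeMonoid.ofList (v.toList.take m), FreeMonoid.ofList (v.toList.drop m), ?_, ?_⟩
  · exact List.take_append_drop m v.toList
  · exact List.length_take_of_le h

/-- Leading forms of equal degree elements commuting with `F` (of large degree) are
proportional. -/
theorem proportional {F a b : MonoidAlgebra k (FreeMonoid X)} (hF : F ≠ 0) (ha : a ≠ 0)
    (hb : b ≠ 0) (hd : deg a = deg b) (hle : deg a ≤ deg F)
    (hFa : F * a = a * F) (hFb : F * b = b * F) :
    ∃ c : k, ∀ v : FreeMonoid X, v.length = deg a → a.coeff v = c * b.coeff v := by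
  obtain ⟨u, hu, hu'⟩ := exists_top hF
  obtain ⟨v0, t, rfl, hv0⟩ := split_word u (deg a) (by omega)
  obtain ⟨w, hw, hw'⟩ := exists_top ha
  obtain ⟨w', hw1, hw1'⟩ := exists_top hb
  rw [FreeMonoid.length_mul] at hu
  have key : ∀ e : MonoidAlgebra k (FreeMonoid X), deg e = deg a → F * e = e * F →
      ∀ v w : FreeMonoid X, v.length = deg a → w.length = deg a →
        F.coeff (v * t) * e.coeff w = e.coeff v * F.coeff (t * w) := by
    intro e he hFe v w hv hw
    rw [← coeff_top_mul F e (by rw [FreeMonoid.length_mul]; omega) (by omega),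
      ← coeff_top_mul e F (by omega) (by rw [FreeMonoid.length_mul]; omega), hFe, mul_assoc]
  have hne : F.coeff (t * w) ≠ 0 := by
    intro h0
    have := key a rfl hFa v0 w hv0 hw
    rw [h0, mul_zero] at this
    exact mul_ne_zero hu' hw' this
  refine ⟨F.coeff (t * w') * a.coeff w / (F.coeff (t * w) * b.coeff w'), fun v hv => ?_⟩
  have h1 := key a rfl hFa v w hv hw
  have h2 := key b hd.symm hFb v w' hv (by omega)
  field_simp
  linear_combination (-b.coeff w') * h1 + a.coeff w * h2

theorem exists_reduce {f a b : MonoidAlgebra k (FreeMonoid X)} (hf : 0 < deg f)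
    (ha : 0 < deg a) (hb : b ≠ 0) (hd : deg a = deg b)
    (hfa : Commute f a) (hfb : Commute f b) : ∃ c : k, deg (a - c • b) < deg a := by
  have hf0 : f ≠ 0 := by rintro rfl; simp [deg] at hf
  have ha0 : a ≠ 0 := by rintro rfl; simp [deg] at ha
  obtain ⟨c, hc⟩ := proportional (F := f ^ deg a) (pow_ne_zero _ hf0) ha0 hb hd
    (by rw [deg_pow hf0]; exact Nat.le_mul_of_pos_right _ hf) (hfa.pow_left _) (hfb.pow_left _)
  refine ⟨c, ?_⟩
  have : deg (a - c • b) ≤ deg a - 1 := by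
    apply deg_le
    intro v hv
    have hle : v.length ≤ deg a := by
      by_contra hlt
      apply hv
      have h1 : a.coeff v = 0 := by
        by_contra h; exact hlt (le_deg h)
      have h2 : b.coeff v = 0 := by
        by_contra h; exact hlt (hd ▸ le_deg h)
      simp [h1, h2]
    have hne : v.length ≠ deg a := by
      intro h
      apply hv
      simp [hc v h]
    omega
  omega

theorem exists_gen {f : MonoidAlgebra k (FreeMonoid X)} (hf : 0 < deg f) :
    ∃ p, Commute f p ∧ p ≠ 0 ∧ ∀ g, Commute f g → g ≠ 0 → deg f * deg p ≤ deg g →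
      ∃ i j, deg g = deg (p ^ i * f ^ j) := by
  have hf0 : f ≠ 0 := by rintro rfl; simp [deg] at hf
  haveI : NeZero (deg f) := ⟨hf.ne'⟩
  let H : AddSubgroup (ZMod (deg f)) :=
    { carrier := {x | ∃ g, Commute f g ∧ g ≠ 0 ∧ (deg g : ZMod (deg f)) = x}
      zero_mem' := ⟨1, Commute.one_right f, one_ne_zero, by simp [deg_one]⟩
      add_mem' := by
        rintro _ _ ⟨g, hg, hg0, rfl⟩ ⟨h, hh, hh0, rfl⟩
        exact ⟨g * h, hg.mul_right hh, mul_ne_zero hg0 hh0, by simp [deg_mul hg0 hh0]⟩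
      neg_mem' := by
        rintro _ ⟨g, hg, hg0, rfl⟩
        refine ⟨g ^ (deg f - 1), hg.pow_right _, pow_ne_zero _ hg0, ?_⟩
        rw [deg_pow hg0, Nat.cast_mul, Nat.cast_sub hf]
        simp }
  obtain ⟨⟨z, hz⟩, hgen⟩ := IsAddCyclic.exists_generator (α := H)
  obtain ⟨p, hp, hp0, hpz⟩ := hz
  refine ⟨p, hp, hp0, fun g hg hg0 hle => ?_⟩
  obtain ⟨j, hj⟩ := AddSubgroup.mem_zmultiples_iff.1 (hgen ⟨(deg g : ZMod (deg f)), g, hg, hg0, rfl⟩)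
  have hj' : j • z = (deg g : ZMod (deg f)) := congrArg Subtype.val hj
  rw [zsmul_eq_mul, ← hpz] at hj'
  set i := (j : ZMod (deg f)).val with hi
  have hlt : i < deg f := ZMod.val_lt _
  have hcast : ((i * deg p : ℕ) : ZMod (deg f)) = (deg g : ZMod (deg f)) := by
    rw [Nat.cast_mul, hi, ZMod.natCast_zmod_val, hj']
  have hle' : i * deg p ≤ deg g := (Nat.mul_le_mul_right _ hlt.le).trans hle
  have hdvd : deg f ∣ deg g - i * deg p :=
    (Nat.modEq_iff_dvd' hle').1 ((ZMod.natCast_eq_natCast_iff _ _ _).1 hcast)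
  obtain ⟨q, hq⟩ := hdvd
  refine ⟨i, q, ?_⟩
  rw [deg_mul (pow_ne_zero _ hp0) (pow_ne_zero _ hf0), deg_pow hp0, deg_pow hf0, mul_comm q]
  omega

theorem approx {f p h : MonoidAlgebra k (FreeMonoid X)} (hf : 0 < deg f) (hp : Commute f p)
    (hp0 : p ≠ 0) {B : ℕ}
    (hB : ∀ g, Commute f g → g ≠ 0 → B ≤ deg g → ∃ i j, deg g = deg (p ^ i * f ^ j))
    (hfh : Commute f h) (hph : Commute p h) (n : ℕ) :
    ∀ g, Commute f g → deg g ≤ n → ∃ r, deg r ≤ B ∧ Commute (g - r) h := by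
  have hf0 : f ≠ 0 := by rintro rfl; simp [deg] at hf
  induction n with
  | zero => exact fun g hg hn => ⟨g, by omega, by simp⟩
  | succ n ih =>
    intro g hg hn
    by_cases hgB : deg g ≤ B
    · exact ⟨g, hgB, by simp⟩
    have hg0 : g ≠ 0 := by rintro rfl; simp [deg] at hgB
    obtain ⟨i, j, hij⟩ := hB g hg hg0 (by omega)
    have hq : Commute f (p ^ i * f ^ j) :=
      (hp.pow_right i).mul_right ((Commute.refl f).pow_right j)
    obtain ⟨c, hc⟩ := exists_reduce hf (by omega)
      (mul_ne_zero (pow_ne_zero i hp0) (pow_ne_zero j hf0)) hij hg hq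
    obtain ⟨r, hr, hr'⟩ := ih (g - c • (p ^ i * f ^ j)) (hg.sub_right (hq.smul_right c)) (by omega)
    refine ⟨r, hr, ?_⟩
    have h2 : Commute (c • (p ^ i * f ^ j)) h :=
      ((hph.pow_left i).mul_left (hfh.pow_left j)).smul_left c
    have := hr'.add_left h2
    rwa [show g - c • (p ^ i * f ^ j) - r + c • (p ^ i * f ^ j) = g - r by abel] at this

theorem commute_of_commute_gen {f p h : MonoidAlgebra k (FreeMonoid X)} (hf : 0 < deg f)
    (hp : Commute f p) (hp0 : p ≠ 0) {B : ℕ}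
    (hB : ∀ g, Commute f g → g ≠ 0 → B ≤ deg g → ∃ i j, deg g = deg (p ^ i * f ^ j))
    (hfh : Commute f h) (hph : Commute p h) (g : MonoidAlgebra k (FreeMonoid X))
    (hg : Commute f g) : Commute g h := by
  have hf0 : f ≠ 0 := by rintro rfl; simp [deg] at hf
  by_contra hgh
  have hne : g * h - h * g ≠ 0 := fun h0 => hgh (sub_eq_zero.1 h0)
  set N := B + deg h + 1 with hN
  obtain ⟨r, hr, hr'⟩ := approx hf hp hp0 hB hfh hph _ (g * f ^ N)
    (hg.mul_right ((Commute.refl f).pow_right N)) le_rfl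
  have hfN : f ^ N * h = h * f ^ N := hfh.pow_left N
  have heq : (g * h - h * g) * f ^ N = r * h - h * r := by
    have h1 : (g * f ^ N - r) * h = h * (g * f ^ N - r) := hr'
    rw [sub_mul, mul_sub, mul_assoc, hfN, sub_eq_sub_iff_sub_eq_sub] at h1
    rw [← h1, sub_mul, mul_assoc, mul_assoc]
  have h1 := congrArg deg heq
  rw [deg_mul hne (pow_ne_zero _ hf0), deg_pow hf0] at h1
  have h2 := deg_sub_le (r * h) (h * r)
  have h3 := deg_mul_le r h
  have h4 := deg_mul_le h r
  have h5 : N ≤ N * deg f := Nat.le_mul_of_pos_right _ hf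
  have h6 : max (deg (r * h)) (deg (h * r)) ≤ B + deg h := max_le (by omega) (by omega)
  omega

theorem main {f g h : MonoidAlgebra k (FreeMonoid X)} (hf : 0 < deg f)
    (hg : Commute f g) (hh : Commute f h) : Commute g h := by
  obtain ⟨p, hp, hp0, hB⟩ := exists_gen hf
  have hc := commute_of_commute_gen hf hp hp0 hB hp (Commute.refl p)
  exact commute_of_commute_gen hf hp hp0 hB hh (hc h hh).symm g hg

end CentFree

theorem centralizer_commutative_free_algebra {k : Type*} [Field k] {s : ℕ}
    (f : FreeAlgebra k (Fin s))
    (hf : f ∉ Set.range (algebraMap k (FreeAlgebra k (Fin s)))) :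
    ∀ g h : FreeAlgebra k (Fin s), f * g = g * f → f * h = h * f → g * h = h * g := by
  intro g h hg hh
  let e := FreeAlgebra.equivMonoidAlgebraFreeMonoid (R := k) (X := Fin s)
  have hpos : 0 < CentFree.deg (e f) := by
    rw [Nat.pos_iff_ne_zero]
    intro h0
    apply hf
    refine ⟨(e f).coeff 1, e.injective ?_⟩
    rw [e.commutes]
    exact (CentFree.eq_algebraMap_of_deg h0).symm
  have := CentFree.main hpos (g := e g) (h := e h)
    (by rw [Commute, SemiconjBy, ← map_mul, hg, map_mul])
    (by rw [Commute, SemiconjBy, ← map_mul, hh, map_mul])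
  apply e.injective
  rw [map_mul, map_mul]
  exact this
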